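/- arXiv:2409.06302 — 3 statements merged into one kernel-verified Lean document; each statement's English description precedes it below -/
import Mathlib

section
/- Let L = (((X_i, μ_i)_{i=1}^k, ω), (ι_i)) be a finite labelled k-partitioned measure 2-network (each X_i a finite set, each μ_i a probability measure on X_i with full support), with label spaces Λ_i real Hilbert spaces. Then there exist ε > 0 and η > 0 such that for every f : X × X → ℝ and every tuple g = (g_i : X_i → Λ_i) satisfying |f(x,y)| < ε for all (x,y) ∈ X × X and ‖g_i(x)‖_{Λ_i} < η for all i and all x ∈ X_i, the path γ_t = (((X_i, μ_i), ω + t f), (ι_i + t g_i)), t ∈ [0,1], is a geodesic from L to (((X_i, μ_i), ω + f), (ι_i + g_i)); that is, d_{LP_k^2}(γ_s, γ_t) = (t − s) · d_{LP_k^2}(γ_0, γ_1) for all 0 ≤ s ≤ t ≤ 1, and this distance is realized by the diagonal k-partitioned couplings ((id × id)_# μ_i)_{i=1}^k. -/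
open scoped Classical

/-- A finite labelled `k`-partitioned measure `2`-network with labels in the real Hilbert
spaces `Λ i`: a finite set `X` (the disjoint union of the blocks) with a partition map
`part : X → Fin k`, probability weights `μ i` with full support on the `i`-th block,
a kernel `ω : X × X → ℝ`, and labelling maps `ι i : X → Λ i`. -/
structure FLNet (k : ℕ) (Λ : Fin k → Type) [∀ i, NormedAddCommGroup (Λ i)]
    [∀ i, InnerProductSpace ℝ (Λ i)] [∀ i, CompleteSpace (Λ i)] where
  X : Type
  fX : Fintype X
  part : X → Fin k
  μ : Fin k → X → ℝ
  μ_nonneg : ∀ i x, 0 ≤ μ i x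
  μ_sum : ∀ i, ∑ x, μ i x = 1
  μ_supp : ∀ i x, 0 < μ i x ↔ part x = i
  ω : X → X → ℝ
  ι : ∀ i, X → Λ i

attribute [instance] FLNet.fX

variable {k : ℕ} {Λ : Fin k → Type} [∀ i, NormedAddCommGroup (Λ i)]
  [∀ i, InnerProductSpace ℝ (Λ i)] [∀ i, CompleteSpace (Λ i)]

/-- A `k`-partitioned coupling between finite networks: nonnegative kernels `π i` with
marginals `μ i` and `μ' i`. -/
def IsFCoupling (L L' : FLNet k Λ) (π : Fin k → L.X → L'.X → ℝ) : Prop :=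
  (∀ i x x', 0 ≤ π i x x') ∧
  (∀ i x, ∑ x', π i x x' = L.μ i x) ∧
  (∀ i x', ∑ x, π i x x' = L'.μ i x')

/-- The cost of a partitioned coupling between finite labelled networks (`p = 2`):
`(1/2) (∑_{i,j} ∑ π_i(x,x') π_j(y,y') |ω(x,y) − ω'(x',y')|²
        + ∑_i ∑ π_i(x,x') ‖ι_i(x) − ι'_i(x')‖²)^{1/2}`. -/
noncomputable def fcost (L L' : FLNet k Λ) (π : Fin k → L.X → L'.X → ℝ) : ℝ :=
  2⁻¹ * Real.sqrt
    ((∑ i, ∑ j, ∑ x, ∑ x', ∑ y, ∑ y',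
        π i x x' * π j y y' * (L.ω x y - L'.ω x' y') ^ 2) +
      ∑ i, ∑ x, ∑ x', π i x x' * ‖L.ι i x - L'.ι i x'‖ ^ 2)

/-- The labelled `k`-partitioned network `2`-distance between finite networks:
the infimum of the cost over all `k`-partitioned couplings. -/
noncomputable def fdist (L L' : FLNet k Λ) : ℝ :=
  sInf {c : ℝ | ∃ π, IsFCoupling L L' π ∧ c = fcost L L' π}

/-- The perturbed network `((Xᵢ, μᵢ), ω + t·f, (ιᵢ + t·gᵢ))`. -/
noncomputable def FLNet.perturb (L : FLNet k Λ) (f : L.X → L.X → ℝ)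
    (g : ∀ i, L.X → Λ i) (t : ℝ) : FLNet k Λ :=
  { L with
    ω := fun x y => L.ω x y + t * f x y
    ι := fun i x => L.ι i x + t • g i x }

/-- The diagonal `k`-partitioned coupling `((id × id)_# μ i)`. -/
noncomputable def FLNet.diag (L : FLNet k Λ) : Fin k → L.X → L.X → ℝ :=
  fun i x x' => if x = x' then L.μ i x else 0

open Filter Topology in
theorem exists_pos_forall_le_abs_of_ne_zero {α : Type*} [Finite α] (h : α → ℝ) :
    ∃ c > 0, ∀ a, h a ≠ 0 → c ≤ |h a| := by
  have key : ∀ᶠ c in 𝓝[>] (0 : ℝ), ∀ a, h a ≠ 0 → c ≤ |h a| := by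
    refine eventually_all.2 fun a => ?_
    by_cases ha : h a = 0
    · simp [ha]
    · filter_upwards [Ioc_mem_nhdsGT (abs_pos.2 ha)] with c hc _ using hc.2
  obtain ⟨c, hc, hpos⟩ := (key.and self_mem_nhdsWithin).exists
  exact ⟨c, hpos, hc⟩

/-- A displacement `d` that is either zero or much longer than `a` and `b` does not bring
`s • a` and `t • b` closer together than the parallelogram bound allows. -/
theorem le_norm_add_smul_sub_smul_sq {E : Type*} [NormedAddCommGroup E]
    [InnerProductSpace ℝ E] {d a b : E} {s t ε : ℝ} (hs : 0 ≤ s) (hs1 : s ≤ 1) (ht : 0 ≤ t)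
    (ht1 : t ≤ 1) (ha : ‖a‖ ≤ ε) (hb : ‖b‖ ≤ ε) (hd : d ≠ 0 → 4 * ε ≤ ‖d‖) :
    (s ^ 2 - s * t) * ‖a‖ ^ 2 + (t ^ 2 - s * t) * ‖b‖ ^ 2 ≤ ‖d + (s • a - t • b)‖ ^ 2 := by
  have hu : (s ^ 2 - s * t) * ‖a‖ ^ 2 + (t ^ 2 - s * t) * ‖b‖ ^ 2 ≤ ‖s • a - t • b‖ ^ 2 := by
    have hab := sq_nonneg ‖a - b‖
    rw [norm_sub_sq_real] at hab
    rw [norm_sub_sq_real, norm_smul, norm_smul, real_inner_smul_left, real_inner_smul_right,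
      mul_pow, mul_pow, Real.norm_eq_abs, Real.norm_eq_abs, sq_abs, sq_abs]
    nlinarith [mul_nonneg (mul_nonneg hs ht) hab]
  refine hu.trans (pow_le_pow_left₀ (norm_nonneg _) ?_ 2)
  rcases eq_or_ne d 0 with rfl | h
  · simp
  · have hsa : ‖s • a‖ ≤ ε := by
      rw [norm_smul, Real.norm_of_nonneg hs]
      exact (mul_le_of_le_one_left (norm_nonneg a) hs1).trans ha
    have htb : ‖t • b‖ ≤ ε := by
      rw [norm_smul, Real.norm_of_nonneg ht]
      exact (mul_le_of_le_one_left (norm_nonneg b) ht1).trans hb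
    have hsub := norm_sub_le (s • a) (t • b)
    have hadd : ‖d‖ ≤ ‖d + (s • a - t • b)‖ + ‖s • a - t • b‖ := by
      simpa using norm_sub_le (d + (s • a - t • b)) (s • a - t • b)
    linarith [hd h]

theorem sum_coupling_mul_add {α β : Type*} [Fintype α] [Fintype β] {π : α → β → ℝ} {p : α → ℝ}
    {q : β → ℝ} (hp : ∀ x, ∑ x', π x x' = p x) (hq : ∀ x', ∑ x, π x x' = q x')
    (φ : α → ℝ) (ψ : β → ℝ) :
    ∑ x, ∑ x', π x x' * (φ x + ψ x') = ∑ x, p x * φ x + ∑ x', q x' * ψ x' := by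
  simp_rw [mul_add, Finset.sum_add_distrib]
  congr 1
  · simp_rw [← Finset.sum_mul, hp]
  · rw [Finset.sum_comm]
    simp_rw [← Finset.sum_mul, hq]

theorem sum_coupling_mul_coupling_mul {α : Type*} [Fintype α] {π ρ : α → α → ℝ} {p q : α → ℝ}
    (hp : ∀ x, ∑ x', π x x' = p x) (hp' : ∀ x', ∑ x, π x x' = p x')
    (hq : ∀ x, ∑ x', ρ x x' = q x) (hq' : ∀ x', ∑ x, ρ x x' = q x')
    (A : α → α → ℝ) (a b : ℝ) :
    ∑ x, ∑ x', ∑ y, ∑ y', π x x' * ρ y y' * (a * A x y + b * A x' y') =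
      (a + b) * ∑ x, ∑ y, p x * q y * A x y := by
  have inner (x x' : α) : ∑ y, ∑ y', π x x' * ρ y y' * (a * A x y + b * A x' y') =
      π x x' * (∑ y, q y * (a * A x y) + ∑ y, q y * (b * A x' y)) := by
    rw [← sum_coupling_mul_add hq hq']
    simp_rw [Finset.mul_sum, mul_assoc]
  simp_rw [inner]
  rw [sum_coupling_mul_add hp hp' (fun x => ∑ y, q y * (a * A x y))
    (fun x => ∑ y, q y * (b * A x y)), ← Finset.sum_add_distrib, Finset.mul_sum]
  refine Finset.sum_congr rfl fun x _ => ?_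
  rw [Finset.mul_sum, Finset.mul_sum, Finset.mul_sum, ← Finset.sum_add_distrib]
  exact Finset.sum_congr rfl fun y _ => by ring

/-- The squared `L²` size of a perturbation `(f, g)` of `L`. -/
noncomputable def FLNet.energy (L : FLNet k Λ) (f : L.X → L.X → ℝ) (g : ∀ i, L.X → Λ i) : ℝ :=
  (∑ i, ∑ j, ∑ x, ∑ y, L.μ i x * L.μ j y * f x y ^ 2) + ∑ i, ∑ x, L.μ i x * ‖g i x‖ ^ 2

theorem FLNet.sum_coupling_eq_energy (L : FLNet k Λ) (f : L.X → L.X → ℝ) (g : ∀ i, L.X → Λ i)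
    {π : Fin k → L.X → L.X → ℝ} (hπ : IsFCoupling L L π) (s t : ℝ) :
    (∑ i, ∑ j, ∑ x, ∑ x', ∑ y, ∑ y', π i x x' * π j y y' *
        ((s ^ 2 - s * t) * f x y ^ 2 + (t ^ 2 - s * t) * f x' y' ^ 2)) +
      ∑ i, ∑ x, ∑ x', π i x x' *
        ((s ^ 2 - s * t) * ‖g i x‖ ^ 2 + (t ^ 2 - s * t) * ‖g i x'‖ ^ 2) =
      (t - s) ^ 2 * L.energy f g := by
  have h₁ (i j : Fin k) := sum_coupling_mul_coupling_mul (hπ.2.1 i) (hπ.2.2 i) (hπ.2.1 j)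
    (hπ.2.2 j) (fun x y => f x y ^ 2) (s ^ 2 - s * t) (t ^ 2 - s * t)
  have h₂ (i : Fin k) : ∑ x, ∑ x', π i x x' *
      ((s ^ 2 - s * t) * ‖g i x‖ ^ 2 + (t ^ 2 - s * t) * ‖g i x'‖ ^ 2) =
      (s ^ 2 - s * t + (t ^ 2 - s * t)) * ∑ x, L.μ i x * ‖g i x‖ ^ 2 := by
    rw [sum_coupling_mul_add (hπ.2.1 i) (hπ.2.2 i) (fun x => (s ^ 2 - s * t) * ‖g i x‖ ^ 2)
      (fun x => (t ^ 2 - s * t) * ‖g i x‖ ^ 2), ← Finset.sum_add_distrib, Finset.mul_sum]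
    exact Finset.sum_congr rfl fun x _ => by ring
  simp_rw [h₁, h₂, energy, ← Finset.mul_sum]
  ring

theorem FLNet.isFCoupling_diag (L : FLNet k Λ) : IsFCoupling L L L.diag := by
  refine ⟨fun i x x' => ?_, fun i x => ?_, fun i x' => ?_⟩
  · unfold diag
    split_ifs
    exacts [L.μ_nonneg i x, le_rfl]
  · simp [diag]
  · simp [diag]

theorem FLNet.fcost_perturb_diag (L : FLNet k Λ) (f : L.X → L.X → ℝ) (g : ∀ i, L.X → Λ i)
    {s t : ℝ} (hst : s ≤ t) :
    fcost (L.perturb f g s) (L.perturb f g t) L.diag =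
      2⁻¹ * ((t - s) * √(L.energy f g)) := by
  rw [← Real.sqrt_sq (sub_nonneg.2 hst), ← Real.sqrt_mul (sq_nonneg _),
    ← L.sum_coupling_eq_energy f g L.isFCoupling_diag s t]
  change 2⁻¹ * √((∑ i, ∑ j, ∑ x, ∑ x', ∑ y, ∑ y', L.diag i x x' * L.diag j y y' *
      (L.ω x y + s * f x y - (L.ω x' y' + t * f x' y')) ^ 2) +
    ∑ i, ∑ x, ∑ x', L.diag i x x' *
      ‖L.ι i x + s • g i x - (L.ι i x' + t • g i x')‖ ^ 2) = _
  congr 3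
  · refine Finset.sum_congr rfl fun i _ => Finset.sum_congr rfl fun j _ =>
      Finset.sum_congr rfl fun x _ => Finset.sum_congr rfl fun x' _ =>
      Finset.sum_congr rfl fun y _ => Finset.sum_congr rfl fun y' _ => ?_
    by_cases hx : x = x'
    · by_cases hy : y = y'
      · subst hx hy
        ring
      · simp [diag, hy]
    · simp [diag, hx]
  · refine Finset.sum_congr rfl fun i _ => Finset.sum_congr rfl fun x _ =>
      Finset.sum_congr rfl fun x' _ => ?_
    by_cases hx : x = x'
    · subst hx
      rw [add_sub_add_left_eq_sub, ← sub_smul, norm_smul, mul_pow, Real.norm_eq_abs, sq_abs]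
      ring
    · simp [diag, hx]

theorem FLNet.le_fcost_perturb (L : FLNet k Λ) {f : L.X → L.X → ℝ} {g : ∀ i, L.X → Λ i}
    {ε η : ℝ} (hω : ∀ x y x' y', L.ω x y - L.ω x' y' ≠ 0 → 4 * ε ≤ |L.ω x y - L.ω x' y'|)
    (hι : ∀ i x x', L.ι i x - L.ι i x' ≠ 0 → 4 * η ≤ ‖L.ι i x - L.ι i x'‖)
    (hf : ∀ x y, |f x y| ≤ ε) (hg : ∀ i x, ‖g i x‖ ≤ η) {s t : ℝ} (hs : 0 ≤ s) (hst : s ≤ t)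
    (ht : t ≤ 1) {π : Fin k → L.X → L.X → ℝ} (hπ : IsFCoupling L L π) :
    2⁻¹ * ((t - s) * √(L.energy f g)) ≤
      fcost (L.perturb f g s) (L.perturb f g t) π := by
  rw [← Real.sqrt_sq (sub_nonneg.2 hst), ← Real.sqrt_mul (sq_nonneg _),
    ← L.sum_coupling_eq_energy f g hπ s t]
  change _ ≤ 2⁻¹ * √((∑ i, ∑ j, ∑ x, ∑ x', ∑ y, ∑ y', π i x x' * π j y y' *
      (L.ω x y + s * f x y - (L.ω x' y' + t * f x' y')) ^ 2) +
    ∑ i, ∑ x, ∑ x', π i x x' *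
      ‖L.ι i x + s • g i x - (L.ι i x' + t • g i x')‖ ^ 2)
  refine mul_le_mul_of_nonneg_left (Real.sqrt_le_sqrt (add_le_add ?_ ?_)) (by norm_num)
  · refine Finset.sum_le_sum fun i _ => Finset.sum_le_sum fun j _ =>
      Finset.sum_le_sum fun x _ => Finset.sum_le_sum fun x' _ =>
      Finset.sum_le_sum fun y _ => Finset.sum_le_sum fun y' _ =>
      mul_le_mul_of_nonneg_left ?_ (mul_nonneg (hπ.1 i x x') (hπ.1 j y y'))
    have h := le_norm_add_smul_sub_smul_sq hs (hst.trans ht) (hs.trans hst) ht (hf x y)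
      (hf x' y') (hω x y x' y')
    simp only [Real.norm_eq_abs, sq_abs, smul_eq_mul] at h
    rwa [add_sub_add_comm]
  · refine Finset.sum_le_sum fun i _ => Finset.sum_le_sum fun x _ =>
      Finset.sum_le_sum fun x' _ => mul_le_mul_of_nonneg_left ?_ (hπ.1 i x x')
    rw [add_sub_add_comm]
    exact le_norm_add_smul_sub_smul_sq hs (hst.trans ht) (hs.trans hst) ht (hg i x) (hg i x')
      (hι i x x')

/-- STATEMENT 15: for a finite labelled `k`-partitioned measure `2`-network `L` there are
`ε, η > 0` such that for any perturbation `(f, g)` with `|f| < ε` and `‖g‖ < η` pointwise,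
the path `γ_t = ((Xᵢ, μᵢ), ω + t·f, (ιᵢ + t·gᵢ))`, `t ∈ [0,1]`, is a geodesic from `L` to
the perturbed network, and the distance `d(γ_s, γ_t)` is realized by the diagonal
partitioned couplings. -/
theorem perturb_is_geodesic (hk : 1 ≤ k) (L : FLNet k Λ) :
    ∃ ε > (0 : ℝ), ∃ η > (0 : ℝ),
      ∀ (f : L.X → L.X → ℝ) (g : ∀ i, L.X → Λ i),
        (∀ x y, |f x y| < ε) → (∀ i x, ‖g i x‖ < η) →
        ∀ s t : ℝ, 0 ≤ s → s ≤ t → t ≤ 1 →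
          fdist (L.perturb f g s) (L.perturb f g t) =
            (t - s) * fdist (L.perturb f g 0) (L.perturb f g 1) ∧
          IsFCoupling (L.perturb f g s) (L.perturb f g t) L.diag ∧
          fcost (L.perturb f g s) (L.perturb f g t) L.diag =
            fdist (L.perturb f g s) (L.perturb f g t) := by
  obtain ⟨c, hc, hω⟩ := exists_pos_forall_le_abs_of_ne_zero
    fun p : (L.X × L.X) × L.X × L.X => L.ω p.1.1 p.1.2 - L.ω p.2.1 p.2.2
  obtain ⟨e, he, hι⟩ := exists_pos_forall_le_abs_of_ne_zero
    fun p : Fin k × L.X × L.X => ‖L.ι p.1 p.2.1 - L.ι p.1 p.2.2‖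
  refine ⟨c / 4, by positivity, e / 4, by positivity, fun f g hf hg => ?_⟩
  have hdist {s t : ℝ} (hs : 0 ≤ s) (hst : s ≤ t) (ht : t ≤ 1) :
      fdist (L.perturb f g s) (L.perturb f g t) = 2⁻¹ * ((t - s) * √(L.energy f g)) := by
    refine IsLeast.csInf_eq
      ⟨⟨L.diag, L.isFCoupling_diag, (L.fcost_perturb_diag f g hst).symm⟩, ?_⟩
    rintro _ ⟨π, hπ, rfl⟩
    refine L.le_fcost_perturb (ε := c / 4) (η := e / 4) (fun x y x' y' h => ?_)
      (fun i x x' h => ?_) (fun x y => (hf x y).le) (fun i x => (hg i x).le) hs hst ht hπ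
    · linarith [hω ((x, y), x', y') h]
    · have := hι (i, x, x') (norm_ne_zero_iff.2 h)
      rw [abs_norm] at this
      linarith
  intro s t hs hst ht
  refine ⟨?_, L.isFCoupling_diag, ?_⟩
  · rw [hdist hs hst ht, hdist le_rfl zero_le_one le_rfl]
    ring
  · rw [hdist hs hst ht, L.fcost_perturb_diag f g hst]
end

section
/- Let L = (((X_i, μ_i)_{i=1}^k, ω), (ι_i)) be a finite labelled k-partitioned measure 2-network with label spaces Λ_i real Hilbert spaces, and let ε > 0 and η > 0 be the constants from the exponential-map geodesic property of L (namely: for any perturbations bounded by ε and η, the diagonal couplings are optimal between L and the perturbed network). If f, f' : X × X → ℝ and g = (g_i), g' = (g'_i) with g_i, g'_i : X_i → Λ_i satisfy |f(x,y)| < ε/2, |f'(x,y)| < ε/2, ‖g_i(x)‖ < η/2, and ‖g'_i(x)‖ < η/2 for all arguments, and if d_{LP_k^2}((((X_i,μ_i), ω + f), (ι_i + g_i)), (((X_i,μ_i), ω + f'), (ι_i + g'_i))) = 0, then there exists a k-partitioned coupling (π_i)_{i=1}^k of (μ_i) with itself such that f(x, y) = f'(x', y') for π ⊗ π-almost every (x,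 x', y, y') and g_i(x) = g'_i(x') for π_i-almost every (x, x'); that is, the exponential map at L is injective on this set of tangent vectors. -/
open scoped Classical

variable {k : ℕ} {Λ : Fin k → Type} [∀ i, NormedAddCommGroup (Λ i)]
  [∀ i, InnerProductSpace ℝ (Λ i)] [∀ i, CompleteSpace (Λ i)]

namespace FLNet

section Distortion

set_option linter.unusedSectionVars false

variable {X Y : Type} [Fintype X] [Fintype Y]

/-- The kernel part of the squared cost of a partitioned coupling. -/
noncomputable def distortion (π : Fin k → X → Y → ℝ) (a : X → X → ℝ) (b : Y → Y → ℝ) : ℝ :=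
  ∑ i, ∑ j, ∑ x, ∑ x', ∑ y, ∑ y', π i x x' * π j y y' * (a x y - b x' y') ^ 2

/-- The label part of the squared cost of a partitioned coupling. -/
noncomputable def labelDistortion (π : Fin k → X → Y → ℝ) (p : ∀ i, X → Λ i)
    (q : ∀ i, Y → Λ i) : ℝ :=
  ∑ i, ∑ x, ∑ x', π i x x' * ‖p i x - q i x'‖ ^ 2

variable {π : Fin k → X → Y → ℝ}

theorem distortion_nonneg (hπ : ∀ i x x', 0 ≤ π i x x') (a : X → X → ℝ) (b : Y → Y → ℝ) :
    0 ≤ distortion π a b := by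
  unfold distortion
  repeat refine Finset.sum_nonneg fun _ _ => ?_
  exact mul_nonneg (mul_nonneg (hπ _ _ _) (hπ _ _ _)) (sq_nonneg _)

theorem labelDistortion_nonneg (hπ : ∀ i x x', 0 ≤ π i x x') (p : ∀ i, X → Λ i)
    (q : ∀ i, Y → Λ i) : 0 ≤ labelDistortion π p q := by
  unfold labelDistortion
  repeat refine Finset.sum_nonneg fun _ _ => ?_
  exact mul_nonneg (hπ _ _ _) (sq_nonneg _)

theorem eq_of_distortion_eq_zero (hπ : ∀ i x x', 0 ≤ π i x x') {a : X → X → ℝ} {b : Y → Y → ℝ}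
    (h : distortion π a b = 0) {i j : Fin k} {x y : X} {x' y' : Y} (hx : π i x x' ≠ 0)
    (hy : π j y y' ≠ 0) : a x y = b x' y' := by
  have hnn : ∀ i j x x' y y', 0 ≤ π i x x' * π j y y' * (a x y - b x' y') ^ 2 :=
    fun _ _ _ _ _ _ => mul_nonneg (mul_nonneg (hπ _ _ _) (hπ _ _ _)) (sq_nonneg _)
  have key : π i x x' * π j y y' * (a x y - b x' y') ^ 2 ≤ distortion π a b := by
    unfold distortion
    refine le_trans ?_ (Finset.single_le_sum (fun _ _ => ?_) (Finset.mem_univ i))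
    · refine le_trans ?_ (Finset.single_le_sum (fun _ _ => ?_) (Finset.mem_univ j))
      · refine le_trans ?_ (Finset.single_le_sum (fun _ _ => ?_) (Finset.mem_univ x))
        · refine le_trans ?_ (Finset.single_le_sum (fun _ _ => ?_) (Finset.mem_univ x'))
          · refine le_trans ?_ (Finset.single_le_sum (fun _ _ => ?_) (Finset.mem_univ y))
            · exact Finset.single_le_sum (f := fun y' => π i x x' * π j y y' *
                (a x y - b x' y') ^ 2) (fun _ _ => hnn _ _ _ _ _ _) (Finset.mem_univ y')
            · repeat refine Finset.sum_nonneg fun _ _ => ?_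
              exact hnn _ _ _ _ _ _
          · repeat refine Finset.sum_nonneg fun _ _ => ?_
            exact hnn _ _ _ _ _ _
        · repeat refine Finset.sum_nonneg fun _ _ => ?_
          exact hnn _ _ _ _ _ _
      · repeat refine Finset.sum_nonneg fun _ _ => ?_
        exact hnn _ _ _ _ _ _
    · repeat refine Finset.sum_nonneg fun _ _ => ?_
      exact hnn _ _ _ _ _ _
  have h0 := le_antisymm (key.trans_eq h) (hnn _ _ _ _ _ _)
  simpa [hx, hy, sub_eq_zero] using h0

theorem eq_of_labelDistortion_eq_zero (hπ : ∀ i x x', 0 ≤ π i x x') {p : ∀ i, X → Λ i}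
    {q : ∀ i, Y → Λ i} (h : labelDistortion π p q = 0) {i : Fin k} {x : X} {x' : Y}
    (hx : π i x x' ≠ 0) : p i x = q i x' := by
  have hnn : ∀ i x x', 0 ≤ π i x x' * ‖p i x - q i x'‖ ^ 2 :=
    fun _ _ _ => mul_nonneg (hπ _ _ _) (sq_nonneg _)
  have key : π i x x' * ‖p i x - q i x'‖ ^ 2 ≤ labelDistortion π p q := by
    unfold labelDistortion
    refine le_trans ?_ (Finset.single_le_sum (fun _ _ => ?_) (Finset.mem_univ i))
    · refine le_trans ?_ (Finset.single_le_sum (fun _ _ => ?_) (Finset.mem_univ x))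
      · exact Finset.single_le_sum (f := fun x' => π i x x' * ‖p i x - q i x'‖ ^ 2)
          (fun _ _ => hnn _ _ _) (Finset.mem_univ x')
      · exact Finset.sum_nonneg fun _ _ => hnn _ _ _
    · exact Finset.sum_nonneg fun _ _ => Finset.sum_nonneg fun _ _ => hnn _ _ _
  have h0 := le_antisymm (key.trans_eq h) (hnn _ _ _)
  simpa [hx, sub_eq_zero] using h0

theorem distortion_congr {a : X → X → ℝ} {b : Y → Y → ℝ} {c : X → X → ℝ} {d : Y → Y → ℝ}
    (h : ∀ i j x x' y y', π i x x' ≠ 0 → π j y y' ≠ 0 → a x y - b x' y' = c x y - d x' y') :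
    distortion π a b = distortion π c d := by
  unfold distortion
  refine Finset.sum_congr rfl fun i _ => Finset.sum_congr rfl fun j _ =>
    Finset.sum_congr rfl fun x _ => Finset.sum_congr rfl fun x' _ =>
    Finset.sum_congr rfl fun y _ => Finset.sum_congr rfl fun y' _ => ?_
  by_cases hx : π i x x' = 0
  · simp [hx]
  by_cases hy : π j y y' = 0
  · simp [hy]
  rw [h i j x x' y y' hx hy]

theorem labelDistortion_congr {p : ∀ i, X → Λ i} {q : ∀ i, Y → Λ i} {r : ∀ i, X → Λ i}
    {s : ∀ i, Y → Λ i} (h : ∀ i x x', π i x x' ≠ 0 → p i x - q i x' = r i x - s i x') :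
    labelDistortion π p q = labelDistortion π r s := by
  unfold labelDistortion
  refine Finset.sum_congr rfl fun i _ => Finset.sum_congr rfl fun x _ =>
    Finset.sum_congr rfl fun x' _ => ?_
  by_cases hx : π i x x' = 0
  · simp [hx]
  rw [h i x x' hx]

end Distortion

section Coupling

variable {L L' : FLNet k Λ} {π : Fin k → L.X → L'.X → ℝ}

theorem fcost_eq (L L' : FLNet k Λ) (π : Fin k → L.X → L'.X → ℝ) :
    fcost L L' π =
      2⁻¹ * Real.sqrt (distortion π L.ω L'.ω + labelDistortion π L.ι L'.ι) :=
  rfl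

theorem le_left (hπ : IsFCoupling L L' π) (i : Fin k) (x : L.X) (x' : L'.X) :
    π i x x' ≤ L.μ i x := by
  rw [← hπ.2.1 i x]
  exact Finset.single_le_sum (f := fun x' => π i x x') (fun _ _ => hπ.1 _ _ _)
    (Finset.mem_univ x')

theorem le_right (hπ : IsFCoupling L L' π) (i : Fin k) (x : L.X) (x' : L'.X) :
    π i x x' ≤ L'.μ i x' := by
  rw [← hπ.2.2 i x']
  exact Finset.single_le_sum (f := fun x => π i x x') (fun _ _ => hπ.1 _ _ _) (Finset.mem_univ x)

theorem part_left (hπ : IsFCoupling L L' π) {i : Fin k} {x : L.X} {x' : L'.X}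
    (h : π i x x' ≠ 0) : L.part x = i :=
  (L.μ_supp i x).1 (((hπ.1 i x x').lt_of_ne' h).trans_le (le_left hπ i x x'))

theorem part_right (hπ : IsFCoupling L L' π) {i : Fin k} {x : L.X} {x' : L'.X}
    (h : π i x x' ≠ 0) : L'.part x' = i :=
  (L'.μ_supp i x').1 (((hπ.1 i x x').lt_of_ne' h).trans_le (le_right hπ i x x'))

theorem exists_right (hπ : IsFCoupling L L' π) (x : L.X) : ∃ x', π (L.part x) x x' ≠ 0 := by
  by_contra! h
  have := hπ.2.1 (L.part x) x
  simp only [h, Finset.sum_const_zero] at this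
  exact ((L.μ_supp _ x).2 rfl).ne this

theorem exists_left (hπ : IsFCoupling L L' π) (x' : L'.X) : ∃ x, π (L'.part x') x x' ≠ 0 := by
  by_contra! h
  have := hπ.2.2 (L'.part x') x'
  simp only [h, Finset.sum_const_zero] at this
  exact ((L'.μ_supp _ x').2 rfl).ne this

theorem sum_mul_left (hπ : IsFCoupling L L' π) (i : Fin k) (F : L.X → ℝ) :
    ∑ x, ∑ x', π i x x' * F x = ∑ x, L.μ i x * F x := by
  simp_rw [← Finset.sum_mul, hπ.2.1]

theorem sum_mul_right (hπ : IsFCoupling L L' π) (i : Fin k) (F : L'.X → ℝ) :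
    ∑ x, ∑ x', π i x x' * F x' = ∑ x', L'.μ i x' * F x' := by
  rw [Finset.sum_comm]
  simp_rw [← Finset.sum_mul, hπ.2.2]

/-- The squared `L²`-norm of a kernel on a network. -/
noncomputable def sqNorm (L : FLNet k Λ) (a : L.X → L.X → ℝ) : ℝ :=
  ∑ i, ∑ j, ∑ x, L.μ i x * ∑ y, L.μ j y * a x y ^ 2

/-- The squared `L²`-norm of a family of label perturbations. -/
noncomputable def labelSqNorm (L : FLNet k Λ) (p : ∀ i, L.X → Λ i) : ℝ :=
  ∑ i, ∑ x, L.μ i x * ‖p i x‖ ^ 2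

theorem sum_sq_left (hπ : IsFCoupling L L' π) (a : L.X → L.X → ℝ) :
    ∑ i, ∑ j, ∑ x, ∑ x', ∑ y, ∑ y', π i x x' * π j y y' * a x y ^ 2 = L.sqNorm a := by
  unfold sqNorm
  refine Finset.sum_congr rfl fun i _ => Finset.sum_congr rfl fun j _ => ?_
  have inner : ∀ x x', ∑ y, ∑ y', π i x x' * π j y y' * a x y ^ 2 =
      π i x x' * ∑ y, L.μ j y * a x y ^ 2 := by
    intro x x'
    rw [← sum_mul_left hπ j fun y => a x y ^ 2]
    simp only [Finset.mul_sum, mul_assoc]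
  simp_rw [inner]
  exact sum_mul_left hπ i fun x => ∑ y, L.μ j y * a x y ^ 2

theorem sum_sq_right (hπ : IsFCoupling L L' π) (b : L'.X → L'.X → ℝ) :
    ∑ i, ∑ j, ∑ x, ∑ x', ∑ y, ∑ y', π i x x' * π j y y' * b x' y' ^ 2 = L'.sqNorm b := by
  unfold sqNorm
  refine Finset.sum_congr rfl fun i _ => Finset.sum_congr rfl fun j _ => ?_
  have inner : ∀ x x', ∑ y, ∑ y', π i x x' * π j y y' * b x' y' ^ 2 =
      π i x x' * ∑ y, L'.μ j y * b x' y ^ 2 := by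
    intro x x'
    rw [← sum_mul_right hπ j fun y => b x' y ^ 2]
    simp only [Finset.mul_sum, mul_assoc]
  simp_rw [inner]
  exact sum_mul_right hπ i fun x => ∑ y, L'.μ j y * b x y ^ 2

theorem distortion_zero_left (hπ : IsFCoupling L L' π) (b : L'.X → L'.X → ℝ) :
    distortion π 0 b = L'.sqNorm b := by
  rw [← sum_sq_right hπ b]
  simp [distortion]

theorem labelDistortion_zero_left (hπ : IsFCoupling L L' π) (q : ∀ i, L'.X → Λ i) :
    labelDistortion π 0 q = L'.labelSqNorm q := by
  unfold labelDistortion labelSqNorm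
  refine Finset.sum_congr rfl fun i _ => ?_
  rw [← sum_mul_right hπ i fun x => ‖q i x‖ ^ 2]
  simp

theorem distortion_neg_smul {π : Fin k → L.X → L.X → ℝ} (hπ : IsFCoupling L L π) (δ : ℝ)
    (u : L.X → L.X → ℝ) :
    distortion π u (fun x y => -(δ * u x y)) =
      (1 + δ) ^ 2 * L.sqNorm u - δ * distortion π u u := by
  have e : (1 + δ) ^ 2 * L.sqNorm u = (1 + δ) * L.sqNorm u + δ * (1 + δ) * L.sqNorm u := by ring
  rw [e]
  nth_rewrite 1 [← sum_sq_left hπ u]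
  nth_rewrite 1 [← sum_sq_right hπ u]
  simp only [distortion, Finset.mul_sum, ← Finset.sum_add_distrib, ← Finset.sum_sub_distrib]
  refine Finset.sum_congr rfl fun i _ => Finset.sum_congr rfl fun j _ =>
    Finset.sum_congr rfl fun x _ => Finset.sum_congr rfl fun x' _ =>
    Finset.sum_congr rfl fun y _ => Finset.sum_congr rfl fun y' _ => ?_
  ring

theorem labelDistortion_neg_smul {π : Fin k → L.X → L.X → ℝ} (hπ : IsFCoupling L L π) (δ : ℝ)
    (u : ∀ i, L.X → Λ i) :
    labelDistortion π u (fun i x => -(δ • u i x)) =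
      (1 + δ) ^ 2 * L.labelSqNorm u - δ * labelDistortion π u u := by
  have e : (1 + δ) ^ 2 * L.labelSqNorm u =
      (1 + δ) * L.labelSqNorm u + δ * (1 + δ) * L.labelSqNorm u := by ring
  rw [e]
  have hl : L.labelSqNorm u = ∑ i, ∑ x, ∑ x', π i x x' * ‖u i x‖ ^ 2 :=
    Finset.sum_congr rfl fun i _ => (sum_mul_left hπ i fun x => ‖u i x‖ ^ 2).symm
  have hr : L.labelSqNorm u = ∑ i, ∑ x, ∑ x', π i x x' * ‖u i x'‖ ^ 2 :=
    Finset.sum_congr rfl fun i _ => (sum_mul_right hπ i fun x => ‖u i x‖ ^ 2).symm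
  nth_rewrite 1 [hl]
  rw [hr]
  simp only [labelDistortion, Finset.mul_sum, ← Finset.sum_add_distrib,
    ← Finset.sum_sub_distrib]
  refine Finset.sum_congr rfl fun i _ =>
    Finset.sum_congr rfl fun x _ => Finset.sum_congr rfl fun x' _ => ?_
  rw [sub_neg_eq_add, norm_add_sq_real, norm_sub_sq_real, norm_smul, inner_smul_right, mul_pow,
    Real.norm_eq_abs, sq_abs]
  ring

theorem sqNorm_neg_smul (L : FLNet k Λ) (c : ℝ) (u : L.X → L.X → ℝ) :
    L.sqNorm (fun x y => -(c * u x y)) = c ^ 2 * L.sqNorm u := by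
  simp only [sqNorm, Finset.mul_sum]
  refine Finset.sum_congr rfl fun i _ => Finset.sum_congr rfl fun j _ =>
    Finset.sum_congr rfl fun x _ => Finset.sum_congr rfl fun y _ => ?_
  ring

theorem labelSqNorm_neg_smul (L : FLNet k Λ) (c : ℝ) (u : ∀ i, L.X → Λ i) :
    L.labelSqNorm (fun i x => -(c • u i x)) = c ^ 2 * L.labelSqNorm u := by
  simp only [labelSqNorm, Finset.mul_sum, norm_neg, norm_smul, mul_pow, Real.norm_eq_abs, sq_abs]
  refine Finset.sum_congr rfl fun i _ => Finset.sum_congr rfl fun x _ => ?_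
  ring

/-- The fibrewise independent self-coupling of a network along a map `s`. -/
noncomputable def fiberCoupling (L : FLNet k Λ) (s : L.X → L.X) : Fin k → L.X → L.X → ℝ :=
  fun i x x' => if s x = s x' then L.μ i x * L.μ i x' / ∑ z with s z = s x, L.μ i z else 0

theorem fiberCoupling_symm (L : FLNet k Λ) (s : L.X → L.X) (i : Fin k) (x x' : L.X) :
    L.fiberCoupling s i x x' = L.fiberCoupling s i x' x := by
  unfold fiberCoupling
  by_cases h : s x = s x'
  · simp [h, mul_comm]
  · simp [h, Ne.symm h]

theorem le_sum_fiber (L : FLNet k Λ) (s : L.X → L.X) (i : Fin k) (x : L.X) :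
    L.μ i x ≤ ∑ z with s z = s x, L.μ i z :=
  Finset.single_le_sum (f := L.μ i) (fun _ _ => L.μ_nonneg _ _) (by simp)

theorem isFCoupling_fiberCoupling (L : FLNet k Λ) (s : L.X → L.X) :
    IsFCoupling L L (L.fiberCoupling s) := by
  have row : ∀ i x, ∑ x', L.fiberCoupling s i x x' = L.μ i x := by
    intro i x
    unfold fiberCoupling
    rw [← Finset.sum_filter, ← Finset.sum_div, ← Finset.mul_sum]
    have hf : (Finset.univ.filter fun x' => s x = s x') =
        Finset.univ.filter fun x' => s x' = s x := by
      simp only [eq_comm]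
    rw [hf]
    by_cases h : ∑ z with s z = s x, L.μ i z = 0
    · rw [h, div_zero]
      exact le_antisymm (L.μ_nonneg i x) ((L.le_sum_fiber s i x).trans_eq h)
    · rw [mul_div_cancel_right₀ _ h]
  refine ⟨fun i x x' => ?_, row, fun i x' => ?_⟩
  · unfold fiberCoupling
    split_ifs
    · exact div_nonneg (mul_nonneg (L.μ_nonneg _ _) (L.μ_nonneg _ _))
        (Finset.sum_nonneg fun _ _ => L.μ_nonneg _ _)
    · exact le_rfl
  · simp_rw [L.fiberCoupling_symm s i _ x', row]

theorem fiberCoupling_ne_zero (L : FLNet k Λ) {s : L.X → L.X} {x x' : L.X} (hs : s x = s x')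
    (hp : L.part x = L.part x') : L.fiberCoupling s (L.part x) x x' ≠ 0 := by
  have hx : 0 < L.μ (L.part x) x := (L.μ_supp _ _).2 rfl
  have hx' : 0 < L.μ (L.part x) x' := (L.μ_supp _ _).2 hp.symm
  have := hx.trans_le (L.le_sum_fiber s _ x)
  unfold fiberCoupling
  rw [if_pos hs]
  positivity

theorem map_eq_of_fiberCoupling_ne_zero (L : FLNet k Λ) {s : L.X → L.X} {i : Fin k} {x x' : L.X}
    (h : L.fiberCoupling s i x x' ≠ 0) : s x = s x' := by
  by_contra hs
  exact h (if_neg hs)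

theorem fcost_nonneg (L L' : FLNet k Λ) (π : Fin k → L.X → L'.X → ℝ) : 0 ≤ fcost L L' π :=
  mul_nonneg (by norm_num) (Real.sqrt_nonneg _)

theorem fdist_le_fcost (hπ : IsFCoupling L L' π) : fdist L L' ≤ fcost L L' π :=
  csInf_le ⟨0, by rintro _ ⟨π, _, rfl⟩; exact fcost_nonneg _ _ _⟩ ⟨π, hπ, rfl⟩

theorem isCompact_setOf_isFCoupling (L L' : FLNet k Λ) :
    IsCompact {π : Fin k → L.X → L'.X → ℝ | IsFCoupling L L' π} := by
  refine (isCompact_Icc (a := fun _ _ _ => (0 : ℝ)) (b := fun i x _ => L.μ i x)).of_isClosed_subset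
    ?_ fun π hπ => ⟨fun i x x' => hπ.1 i x x', fun i x x' => le_left hπ i x x'⟩
  simp only [IsFCoupling, Set.ofPred_and, Set.ofPred_forall]
  refine IsClosed.inter ?_ (IsClosed.inter ?_ ?_)
  · exact isClosed_iInter fun i => isClosed_iInter fun x => isClosed_iInter fun x' =>
      isClosed_le (by fun_prop) (by fun_prop)
  · exact isClosed_iInter fun i => isClosed_iInter fun x =>
      isClosed_eq (by fun_prop) (by fun_prop)
  · exact isClosed_iInter fun i => isClosed_iInter fun x =>
      isClosed_eq (by fun_prop) (by fun_prop)

theorem exists_fcost_eq_fdist (hπ : IsFCoupling L L' π) :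
    ∃ ρ, IsFCoupling L L' ρ ∧ fcost L L' ρ = fdist L L' := by
  obtain ⟨ρ, hρ, hmin⟩ := (isCompact_setOf_isFCoupling L L').exists_isMinOn ⟨π, hπ⟩
    (f := fcost L L') (by unfold fcost; fun_prop)
  refine ⟨ρ, hρ, le_antisymm (le_csInf ⟨_, π, hπ, rfl⟩ ?_) (fdist_le_fcost hρ)⟩
  rintro _ ⟨σ, hσ, rfl⟩
  exact hmin hσ

theorem distortions_eq_zero_of_fcost_eq_zero (hπ : IsFCoupling L L' π) (h : fcost L L' π = 0) :
    distortion π L.ω L'.ω = 0 ∧ labelDistortion π L.ι L'.ι = 0 := by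
  have h₁ := distortion_nonneg hπ.1 L.ω L'.ω
  have h₂ := labelDistortion_nonneg hπ.1 L.ι L'.ι
  rw [fcost_eq, mul_eq_zero, Real.sqrt_eq_zero (add_nonneg h₁ h₂)] at h
  have := h.resolve_left (by norm_num)
  constructor <;> linarith

end Coupling

section Optimal

variable {L : FLNet k Λ} {ε η : ℝ}

/-- Diagonal couplings are optimal between `L` and its `(ε, η)`-bounded perturbations, written
as an inequality between squared costs. -/
def DiagOptimal (L : FLNet k Λ) (ε η : ℝ) : Prop :=
  ∀ (f : L.X → L.X → ℝ) (g : ∀ i, L.X → Λ i), (∀ x y, |f x y| < ε) → (∀ i x, ‖g i x‖ < η) →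
    ∀ π, IsFCoupling L L π → L.sqNorm f + L.labelSqNorm g ≤
      distortion π L.ω (fun x y => L.ω x y + f x y) +
        labelDistortion π L.ι (fun i x => L.ι i x + g i x)

theorem diagOptimal_of_fcost_diag_eq_fdist
    (hgeo : ∀ (f : L.X → L.X → ℝ) (g : ∀ i, L.X → Λ i),
      (∀ x y, |f x y| < ε) → (∀ i x, ‖g i x‖ < η) →
      IsFCoupling L (L.perturb f g 1) L.diag ∧
        fcost L (L.perturb f g 1) L.diag = fdist L (L.perturb f g 1)) :
    L.DiagOptimal ε η := by
  intro f g hf hg π hπ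
  obtain ⟨hd, hopt⟩ := hgeo f g hf hg
  have hd' : IsFCoupling L L L.diag := hd
  have hle : fcost L (L.perturb f g 1) L.diag ≤ fcost L (L.perturb f g 1) π :=
    hopt.trans_le (fdist_le_fcost (L' := L.perturb f g 1) hπ)
  have hω : (L.perturb f g 1).ω = fun x y => L.ω x y + f x y := by
    funext x y; simp [perturb]
  have hι : (L.perturb f g 1).ι = fun i x => L.ι i x + g i x := by
    funext i x; simp [perturb]
  have heq : ∀ {i x x'}, L.diag i x x' ≠ 0 → x = x' := fun h => by
    by_contra hne
    exact h (if_neg hne)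
  have h₁ := distortion_nonneg hπ.1 L.ω (fun x y => L.ω x y + f x y)
  have h₂ := labelDistortion_nonneg hπ.1 L.ι (fun i x => L.ι i x + g i x)
  have hle' : distortion L.diag L.ω (fun x y => L.ω x y + f x y) +
      labelDistortion L.diag L.ι (fun i x => L.ι i x + g i x) ≤
      distortion π L.ω (fun x y => L.ω x y + f x y) +
        labelDistortion π L.ι (fun i x => L.ι i x + g i x) := by
    have := le_of_mul_le_mul_left hle (by norm_num)
    rw [← hω] at h₁ ⊢
    rw [← hι] at h₂ ⊢
    exact (Real.sqrt_le_sqrt_iff (add_nonneg h₁ h₂)).1 this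
  refine le_trans (le_of_eq ?_) hle'
  rw [← distortion_zero_left hd' f, ← labelDistortion_zero_left hd' g]
  congr 1
  · refine distortion_congr fun i j x x' y y' hx hy => ?_
    rw [heq hx, heq hy]
    simp
  · refine labelDistortion_congr fun i x x' hx => ?_
    rw [heq hx]
    simp

/-- If `s` moves every kernel value by less than `ε` and every label by less than `η`, then
kernel and labels are constant on the fibres of `s` within blocks. -/
theorem DiagOptimal.eq_of_map_eq (hL : L.DiagOptimal ε η) (hη : 0 < η)
    {s : L.X → L.X} (hsω : ∀ x y, |L.ω x y - L.ω (s x) (s y)| < ε)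
    (hsι : ∀ x, ‖L.ι (L.part x) x - L.ι (L.part x) (s x)‖ < η) {x x' y y' : L.X}
    (hx : s x = s x') (hxp : L.part x = L.part x') (hy : s y = s y')
    (hyp : L.part y = L.part y') :
    L.ω x y = L.ω x' y' ∧ L.ι (L.part x) x = L.ι (L.part x) x' := by
  set u : L.X → L.X → ℝ := fun x y => L.ω x y - L.ω (s x) (s y) with hu
  set v : ∀ i, L.X → Λ i := fun i x => if L.part x = i then L.ι i x - L.ι i (s x) else 0 with hv
  have hvη : ∀ i x, ‖v i x‖ < η := by
    intro i x
    by_cases h : L.part x = i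
    · subst h
      simpa [hv] using hsι x
    · simpa [hv, h] using hη
  have hev : ∀ {a b : ℝ}, a < b → ∀ᶠ δ in nhdsWithin (0 : ℝ) (Set.Ioi 0), (1 + δ) * a < b := by
    intro a b hab
    have hc : Continuous fun δ : ℝ => (1 + δ) * a := by fun_prop
    exact (hc.tendsto 0).mono_left nhdsWithin_le_nhds |>.eventually_lt_const (by simpa using hab)
  obtain ⟨δ, ⟨h₁, h₂⟩, hδ⟩ : ∃ δ : ℝ, ((∀ x y, (1 + δ) * |u x y| < ε) ∧
      ∀ i x, (1 + δ) * ‖v i x‖ < η) ∧ 0 < δ :=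
    (((Filter.eventually_all.2 fun x => Filter.eventually_all.2 fun y => hev (hsω x y)).and
      (Filter.eventually_all.2 fun i => Filter.eventually_all.2 fun x => hev (hvη i x))).and
      self_mem_nhdsWithin).exists
  have hδ' : 0 < 1 + δ := by positivity
  have hπ := L.isFCoupling_fiberCoupling s
  set π := L.fiberCoupling s with hπdef
  have key := hL (fun x y => -((1 + δ) * u x y)) (fun i x => -((1 + δ) • v i x))
    (fun x y => by simpa [abs_mul, abs_of_pos hδ'] using h₁ x y)
    (fun i x => by simpa [norm_smul, abs_of_pos hδ'] using h₂ i x) π hπ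
  have e₁ : distortion π L.ω (fun x y => L.ω x y + -((1 + δ) * u x y)) =
      distortion π u (fun x y => -(δ * u x y)) := by
    refine distortion_congr fun i j a a' b b' ha hb => ?_
    simp only [hu, L.map_eq_of_fiberCoupling_ne_zero ha, L.map_eq_of_fiberCoupling_ne_zero hb]
    ring
  have e₂ : labelDistortion π L.ι (fun i x => L.ι i x + -((1 + δ) • v i x)) =
      labelDistortion π v (fun i x => -(δ • v i x)) := by
    refine labelDistortion_congr fun i a a' ha => ?_
    simp only [hv, part_left hπ ha, part_right hπ ha, if_true,
      L.map_eq_of_fiberCoupling_ne_zero ha]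
    module
  rw [sqNorm_neg_smul, labelSqNorm_neg_smul, e₁, e₂, distortion_neg_smul hπ,
    labelDistortion_neg_smul hπ] at key
  have n₁ := distortion_nonneg hπ.1 u u
  have n₂ := labelDistortion_nonneg hπ.1 v v
  have hsum : distortion π u u + labelDistortion π v v ≤ 0 := by
    refine nonpos_of_mul_nonpos_right (a := δ) ?_ hδ
    linarith
  have hx0 := L.fiberCoupling_ne_zero hx hxp
  have hy0 := L.fiberCoupling_ne_zero hy hyp
  have r₁ := eq_of_distortion_eq_zero hπ.1 (by linarith : distortion π u u = 0) hx0 hy0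
  have r₂ := eq_of_labelDistortion_eq_zero hπ.1 (by linarith : labelDistortion π v v = 0) hx0
  refine ⟨?_, ?_⟩
  · simpa [hu, hx, hy] using r₁
  · simpa [hv, hx, ← hxp] using r₂

/-- A self-coupling that moves kernel values by less than `ε` and labels by less than `η`
preserves kernel and labels. -/
theorem DiagOptimal.eq_of_isFCoupling (hL : L.DiagOptimal ε η) (hη : 0 < η)
    {π : Fin k → L.X → L.X → ℝ} (hπ : IsFCoupling L L π)
    (hω : ∀ i j x x' y y', π i x x' ≠ 0 → π j y y' ≠ 0 → |L.ω x y - L.ω x' y'| < ε)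
    (hι : ∀ i x x', π i x x' ≠ 0 → ‖L.ι i x - L.ι i x'‖ < η) :
    (∀ i j x x' y y', π i x x' ≠ 0 → π j y y' ≠ 0 → L.ω x y = L.ω x' y') ∧
      ∀ i x x', π i x x' ≠ 0 → L.ι i x = L.ι i x' := by
  choose t ht using fun x => exists_right hπ x
  choose p hp using fun x => exists_left hπ x
  have fiber : ∀ {i x₁ x₂ x'}, π i x₁ x' ≠ 0 → π i x₂ x' ≠ 0 → ∀ y,
      L.ω x₁ y = L.ω x₂ y ∧ L.ω y x₁ = L.ω y x₂ ∧ L.ι i x₁ = L.ι i x₂ := by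
    intro i x₁ x₂ x' h₁ h₂ y
    have p₁ := part_left hπ h₁
    have p₂ := part_left hπ h₂
    set s : L.X → L.X := fun z => if z = x₁ ∨ z = x₂ then x' else t z with hs
    have hsπ : ∀ z, π (L.part z) z (s z) ≠ 0 := by
      intro z
      by_cases hz : z = x₁ ∨ z = x₂
      · simp only [hs, if_pos hz]
        rcases hz with rfl | rfl
        · rwa [p₁]
        · rwa [p₂]
      · simpa only [hs, if_neg hz] using ht z
    have hsx : s x₁ = s x₂ := by simp [hs]
    have hsω := fun z w => hω _ _ z (s z) w (s w) (hsπ z) (hsπ w)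
    have hsι := fun z => hι _ z (s z) (hsπ z)
    have a := hL.eq_of_map_eq hη hsω hsι hsx (p₁.trans p₂.symm) (rfl : s y = s y) rfl
    have b := hL.eq_of_map_eq hη hsω hsι (rfl : s y = s y) rfl hsx (p₁.trans p₂.symm)
    rw [p₁] at a
    exact ⟨a.1, b.1, a.2⟩
  set f : L.X → L.X → ℝ := fun x y => L.ω (p x) (p y) - L.ω x y with hf
  set g : ∀ i, L.X → Λ i :=
    fun i x => if L.part x = i then L.ι i (p x) - L.ι i x else 0 with hg
  have hpω : ∀ {i j x x' y y'}, π i x x' ≠ 0 → π j y y' ≠ 0 → L.ω x y = L.ω (p x') (p y') := by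
    intro i j x x' y y' hx hy
    have hx₂ := hp x'
    have hy₂ := hp y'
    rw [part_right hπ hx] at hx₂
    rw [part_right hπ hy] at hy₂
    exact (fiber hx hx₂ y).1.trans (fiber hy hy₂ _).2.1
  have hpι : ∀ {i x x'}, π i x x' ≠ 0 → L.ι i x = L.ι i (p x') := by
    intro i x x' hx
    have hx₂ := hp x'
    rw [part_right hπ hx] at hx₂
    exact (fiber hx hx₂ x).2.2
  have hgη : ∀ i x, ‖g i x‖ < η := by
    intro i x
    by_cases h : L.part x = i
    · subst h
      simpa [hg] using hι _ _ _ (hp x)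
    · simpa [hg, h] using hη
  have key := hL f g (fun x y => hω _ _ _ _ _ _ (hp x) (hp y)) hgη π hπ
  have z₁ : distortion π L.ω (fun x y => L.ω x y + f x y) = distortion π 0 0 := by
    refine distortion_congr fun i j x x' y y' hx hy => ?_
    simp [hf, hpω hx hy]
  have z₂ : labelDistortion π L.ι (fun i x => L.ι i x + g i x) =
      labelDistortion π (0 : ∀ i, L.X → Λ i) 0 := by
    refine labelDistortion_congr fun i x x' hx => ?_
    simp [hg, part_right hπ hx, hpι hx]
  rw [z₁, z₂, ← distortion_zero_left hπ f, ← labelDistortion_zero_left hπ g] at key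
  have zz₁ : distortion π 0 0 = 0 := by simp [distortion]
  have zz₂ : labelDistortion π (0 : ∀ i, L.X → Λ i) 0 = 0 := by simp [labelDistortion]
  rw [zz₁, zz₂] at key
  have n₁ := distortion_nonneg hπ.1 0 f
  have n₂ := labelDistortion_nonneg hπ.1 0 g
  refine ⟨fun i j x x' y y' hx hy => ?_, fun i x x' hx => ?_⟩
  · have := eq_of_distortion_eq_zero hπ.1 (by linarith : distortion π 0 f = 0) hx hy
    rw [hpω hx hy]
    exact sub_eq_zero.1 this.symm
  · have := eq_of_labelDistortion_eq_zero hπ.1 (by linarith : labelDistortion π 0 g = 0) hx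
    simp only [hg, part_right hπ hx, if_true, Pi.zero_apply] at this
    rw [hpι hx]
    exact sub_eq_zero.1 this.symm

end Optimal

end FLNet

/-- STATEMENT 16: injectivity of the exponential map at a finite labelled `k`-partitioned
measure `2`-network `L` on tangent vectors bounded by `ε/2` and `η/2`, where `ε, η` are
constants for which diagonal couplings are optimal between `L` and any `(ε, η)`-bounded
perturbation of `L`: if two such perturbed networks are at distance zero, then the
corresponding tangent vectors agree almost everywhere with respect to some partitioned
self-coupling of `(μ i)`. -/
theorem exp_injective (hk : 1 ≤ k) (L : FLNet k Λ) (ε η : ℝ) (hε : 0 < ε) (hη : 0 < η)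
    (hgeo : ∀ (f : L.X → L.X → ℝ) (g : ∀ i, L.X → Λ i),
      (∀ x y, |f x y| < ε) → (∀ i x, ‖g i x‖ < η) →
      IsFCoupling L (L.perturb f g 1) L.diag ∧
        fcost L (L.perturb f g 1) L.diag = fdist L (L.perturb f g 1))
    (f f' : L.X → L.X → ℝ) (g g' : ∀ i, L.X → Λ i)
    (hf : ∀ x y, |f x y| < ε / 2) (hf' : ∀ x y, |f' x y| < ε / 2)
    (hg : ∀ i x, ‖g i x‖ < η / 2) (hg' : ∀ i x, ‖g' i x‖ < η / 2)
    (hzero : fdist (L.perturb f g 1) (L.perturb f' g' 1) = 0) :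
    ∃ π : Fin k → L.X → L.X → ℝ, IsFCoupling L L π ∧
      (∀ i j x x' y y', π i x x' ≠ 0 → π j y y' ≠ 0 → f x y = f' x' y') ∧
      (∀ i x x', π i x x' ≠ 0 → g i x = g' i x') := by
  have hL := FLNet.diagOptimal_of_fcost_diag_eq_fdist hgeo
  have hd : IsFCoupling L L L.diag := (hgeo 0 0 (by simp [hε]) (by simp [hη])).1
  obtain ⟨π, hπ', hcost⟩ := FLNet.exists_fcost_eq_fdist
    (L := L.perturb f g 1) (L' := L.perturb f' g' 1) (π := L.diag) hd
  obtain ⟨h₁, h₂⟩ := FLNet.distortions_eq_zero_of_fcost_eq_zero hπ' (hcost.trans hzero)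
  have hπ : IsFCoupling L L π := hπ'
  have eω : ∀ i j x x' y y', π i x x' ≠ 0 → π j y y' ≠ 0 →
      L.ω x y + f x y = L.ω x' y' + f' x' y' := by
    intro i j x x' y y' hx hy
    have := FLNet.eq_of_distortion_eq_zero hπ.1 h₁ hx hy
    simpa [FLNet.perturb] using this
  have eι : ∀ i x x', π i x x' ≠ 0 → L.ι i x + g i x = L.ι i x' + g' i x' := by
    intro i x x' hx
    have := FLNet.eq_of_labelDistortion_eq_zero hπ.1 h₂ hx
    simpa [FLNet.perturb] using this
  obtain ⟨hω, hι⟩ := hL.eq_of_isFCoupling hη hπ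
    (fun i j x x' y y' hx hy => by
      have e : L.ω x y - L.ω x' y' = f' x' y' - f x y := by
        linarith [eω i j x x' y y' hx hy]
      rw [e]
      linarith [abs_sub (f' x' y') (f x y), hf x y, hf' x' y'])
    (fun i x x' hx => by
      have e : L.ι i x - L.ι i x' = g' i x' - g i x := by
        rw [sub_eq_sub_iff_add_eq_add, eι i x x' hx, add_comm]
      rw [e]
      linarith [norm_sub_le (g' i x') (g i x), hg i x, hg' i x'])
  refine ⟨π, hπ, fun i j x x' y y' hx hy => ?_, fun i x x' hx => ?_⟩
  · linarith [eω i j x x' y y' hx hy, hω i j x x' y y' hx hy]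
  · have := eι i x x' hx
    rwa [hι i x x' hx, add_right_inj] at this
end

section
/- Let ((X̄_j, μ̄_j)_{j=1}^k) be a finite k-partitioned probability space with each μ̄_j of full support, let P^{(1)}, …, P^{(N)} be finite k-partitioned measure 2-networks P^{(i)} = ((X_j^{(i)}, μ_j^{(i)})_{j=1}^k, ω^{(i)}), let w_1, …, w_N ≥ 0 with ∑_i w_i > 0, and fix for each i a k-partitioned coupling (π_j^{(i)})_{j=1}^k of (μ̄_j) and (μ_j^{(i)}). Then the function ω̄ ↦ ∑_{i=1}^N w_i ∑_{j,l=1}^k ∬ |ω̄(x,y) − ω^{(i)}(x',y')|^2 dπ_j^{(i)}(x,x') dπ_l^{(i)}(y,y') over functions ω̄ : X̄ × X̄ → ℝ is minimized (uniquely) at ω̄* given blockwise, for x ∈ X̄_j and y ∈ X̄_l, by ω̄*(x,y) = (∑_{i=1}^N w_i ∑_{x',y'} π_j^{(i)}(x,x') ω^{(i)}(x',y') π_l^{(i)}(y,y')) / ( (∑_i w_i) · μ̄_j(x) μ̄_l(y) ); in matrix form, ω̄*_{jl} = (1/(μ̄_j ⊗ μ̄_l)) ∑_i w_i π_j^{(i)}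 ω^{(i)}_{jl} (π_l^{(i)})^⊤ when the weights are normalized to sum to 1. -/
/-- Expansion of a quadratic objective with product weights as a polynomial in `t`. -/
theorem sum_sum_sub_sq_mul_mul {α β : Type*} [Fintype α] [Fintype β] (a : α → ℝ) (b : β → ℝ)
    (c : α → β → ℝ) (t : ℝ) :
    ∑ x, ∑ y, (t - c x y) ^ 2 * a x * b y =
      t ^ 2 * ((∑ x, a x) * ∑ y, b y) - 2 * t * (∑ x, ∑ y, a x * c x y * b y) +
        ∑ x, ∑ y, c x y ^ 2 * a x * b y := by
  rw [Finset.sum_mul_sum]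
  simp only [Finset.mul_sum, ← Finset.sum_add_distrib, ← Finset.sum_sub_distrib]
  refine Finset.sum_congr rfl fun x _ => Finset.sum_congr rfl fun y _ => ?_
  ring

/-- Completing the square: a weighted sum of squared deviations splits at the weighted average. -/
theorem sum_mul_sum_sum_sub_sq_eq {ι : Type*} [Fintype ι] {α β : ι → Type*} [∀ i, Fintype (α i)]
    [∀ i, Fintype (β i)] (w : ι → ℝ) (a : ∀ i, α i → ℝ) (b : ∀ i, β i → ℝ)
    (c : ∀ i, α i → β i → ℝ) (p q s t : ℝ) (ha : ∀ i, ∑ x, a i x = p) (hb : ∀ i, ∑ y, b i y = q)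
    (hs : (∑ i, w i) * p * q * s = ∑ i, w i * ∑ x, ∑ y, a i x * c i x y * b i y) :
    ∑ i, w i * ∑ x, ∑ y, (t - c i x y) ^ 2 * a i x * b i y =
      ∑ i, w i * ∑ x, ∑ y, (s - c i x y) ^ 2 * a i x * b i y +
        (∑ i, w i) * p * q * (t - s) ^ 2 := by
  have key (r : ℝ) : ∑ i, w i * ∑ x, ∑ y, (r - c i x y) ^ 2 * a i x * b i y =
      (∑ i, w i) * p * q * r ^ 2 - 2 * r * ((∑ i, w i) * p * q * s) +
        ∑ i, w i * ∑ x, ∑ y, c i x y ^ 2 * a i x * b i y := by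
    simp only [sum_sum_sub_sq_mul_mul, ha, hb]
    rw [hs, Finset.mul_sum, Finset.sum_mul, Finset.sum_mul, Finset.sum_mul,
      ← Finset.sum_sub_distrib, ← Finset.sum_add_distrib]
    refine Finset.sum_congr rfl fun i _ => ?_
    ring
  rw [key, key]
  ring

/-- A sum over blocks of sums against weights supported on the blocks is a single sum. -/
theorem sum_sum_blocks_eq {κ X Y : Type*} [Fintype κ] [Fintype X] [Fintype Y] (part : X → κ)
    (π : κ → X → Y → ℝ) (hπ : ∀ j x y, part x ≠ j → π j x y = 0) (f : X → X → Y → Y → ℝ) :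
    ∑ j, ∑ l, ∑ x, ∑ y, ∑ x', ∑ y', f x y x' y' * π j x x' * π l y y' =
      ∑ x, ∑ y, ∑ x', ∑ y', f x y x' y' * π (part x) x x' * π (part y) y y' := by
  have inner (j : κ) : ∑ l, ∑ x, ∑ y, ∑ x', ∑ y', f x y x' y' * π j x x' * π l y y' =
      ∑ x, ∑ y, ∑ x', ∑ y', f x y x' y' * π j x x' * π (part y) y y' := by
    rw [Finset.sum_comm]
    refine Finset.sum_congr rfl fun x _ => ?_
    rw [Finset.sum_comm]
    refine Finset.sum_congr rfl fun y _ => ?_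
    refine Fintype.sum_eq_single (part y) fun l hl => ?_
    simp [hπ l y _ hl.symm]
  simp only [inner]
  rw [Finset.sum_comm]
  refine Finset.sum_congr rfl fun x _ => ?_
  refine Fintype.sum_eq_single (part x) fun j hj => ?_
  simp [hπ j x _ hj.symm]

/-- STATEMENT 19 (fixed-support barycenter update): given a finite `k`-partitioned
probability space `(X̄_j, μ̄_j)` with full-support weights, finite `k`-partitioned measure
`2`-networks `P⁽¹⁾, …, P⁽ᴺ⁾`, nonnegative weights `w` with positive sum, and partitioned
couplings `π⁽ⁱ⁾` of `(μ̄_j)` with `(μ^{(i)}_j)`, the quadratic objective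
`ω̄ ↦ ∑ᵢ wᵢ ∑_{j,l} ∑ (ω̄(x,y) − ω⁽ⁱ⁾(x',y'))² π⁽ⁱ⁾_j(x,x') π⁽ⁱ⁾_l(y,y')`
is uniquely minimized at the blockwise weighted average
`ω̄*(x,y) = (∑ᵢ wᵢ ∑_{x',y'} π⁽ⁱ⁾_{j}(x,x') ω⁽ⁱ⁾(x',y') π⁽ⁱ⁾_{l}(y,y'))
            / ((∑ᵢ wᵢ) μ̄_j(x) μ̄_l(y))` for `x ∈ X̄_j`, `y ∈ X̄_l`. -/
theorem barycenter_update (k : ℕ) (hk : 1 ≤ k)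
    -- the common (base) finite k-partitioned probability space
    (Xb : Type) [Fintype Xb] (partb : Xb → Fin k)
    (μb : Fin k → Xb → ℝ)
    (μb_nonneg : ∀ j x, 0 ≤ μb j x)
    (μb_sum : ∀ j, ∑ x, μb j x = 1)
    (μb_supp : ∀ j x, 0 < μb j x ↔ partb x = j)
    -- the input finite k-partitioned measure 2-networks P⁽ⁱ⁾
    (N : ℕ) (hN : 0 < N)
    (Xt : Fin N → Type) [∀ i, Fintype (Xt i)] (partt : ∀ i, Xt i → Fin k)
    (μt : ∀ i, Fin k → Xt i → ℝ)
    (μt_nonneg : ∀ i j x', 0 ≤ μt i j x')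
    (μt_sum : ∀ i j, ∑ x', μt i j x' = 1)
    (μt_supp : ∀ i j x', 0 < μt i j x' ↔ partt i x' = j)
    (ω : ∀ i, Xt i → Xt i → ℝ)
    -- nonnegative weights with positive sum
    (w : Fin N → ℝ) (w_nonneg : ∀ i, 0 ≤ w i) (w_pos : 0 < ∑ i, w i)
    -- a fixed k-partitioned coupling of (μ̄_j) and (μ^{(i)}_j) for each i
    (π : ∀ i, Fin k → Xb → Xt i → ℝ)
    (π_nonneg : ∀ i j x x', 0 ≤ π i j x x')
    (π_fst : ∀ i j x, ∑ x', π i j x x' = μb j x)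
    (π_snd : ∀ i j x', ∑ x, π i j x x' = μt i j x')
    -- the quadratic objective
    (G : (Xb → Xb → ℝ) → ℝ)
    (hG : ∀ ωb, G ωb = ∑ i, w i * ∑ j, ∑ l, ∑ x, ∑ y, ∑ x', ∑ y',
      (ωb x y - ω i x' y') ^ 2 * π i j x x' * π i l y y')
    -- the blockwise weighted average
    (star : Xb → Xb → ℝ)
    (hstar : ∀ x y, star x y =
      (∑ i, w i * ∑ x', ∑ y', π i (partb x) x x' * ω i x' y' * π i (partb y) y y') /
        ((∑ i, w i) * μb (partb x) x * μb (partb y) y)) :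
    (∀ ωb : Xb → Xb → ℝ, G star ≤ G ωb) ∧
    (∀ ωb : Xb → Xb → ℝ, G ωb = G star → ωb = star) := by
  have μ_pos (x : Xb) : 0 < μb (partb x) x := (μb_supp _ _).2 rfl
  have π_zero (i : Fin N) (j : Fin k) (x : Xb) (x' : Xt i) (h : partb x ≠ j) :
      π i j x x' = 0 := by
    have h_sum : ∑ x', π i j x x' = 0 := by
      rw [π_fst]
      exact le_antisymm (not_lt.1 fun h' => h ((μb_supp j x).1 h')) (μb_nonneg j x)
    exact (Finset.sum_eq_zero_iff_of_nonneg fun y _ => π_nonneg i j x y).1 h_sum x'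
      (Finset.mem_univ x')
  have coeff_pos (x y : Xb) : 0 < (∑ i, w i) * μb (partb x) x * μb (partb y) y :=
    mul_pos (mul_pos w_pos (μ_pos x)) (μ_pos y)
  have G_eq (ωb : Xb → Xb → ℝ) : G ωb = ∑ x, ∑ y, ∑ i, w i * ∑ x', ∑ y',
      (ωb x y - ω i x' y') ^ 2 * π i (partb x) x x' * π i (partb y) y y' := by
    rw [hG]
    simp_rw [fun i => sum_sum_blocks_eq partb (π i) (π_zero i)
      (fun x y x' y' => (ωb x y - ω i x' y') ^ 2)]
    simp_rw [Finset.mul_sum (s := (Finset.univ : Finset Xb))]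
    rw [Finset.sum_comm]
    exact Finset.sum_congr rfl fun x _ => Finset.sum_comm
  have G_split (ωb : Xb → Xb → ℝ) : G ωb = G star + ∑ x, ∑ y,
      (∑ i, w i) * μb (partb x) x * μb (partb y) y * (ωb x y - star x y) ^ 2 := by
    rw [G_eq, G_eq]
    simp only [← Finset.sum_add_distrib]
    refine Finset.sum_congr rfl fun x _ => Finset.sum_congr rfl fun y _ => ?_
    refine sum_mul_sum_sum_sub_sq_eq w (fun i => π i (partb x) x) (fun i => π i (partb y) y) ω
      _ _ _ _ (fun i => π_fst i _ x) (fun i => π_fst i _ y) ?_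
    rw [hstar, mul_div_cancel₀ _ (coeff_pos x y).ne']
  have term_nonneg (ωb : Xb → Xb → ℝ) (x y : Xb) :
      0 ≤ (∑ i, w i) * μb (partb x) x * μb (partb y) y * (ωb x y - star x y) ^ 2 :=
    mul_nonneg (coeff_pos x y).le (sq_nonneg _)
  refine ⟨fun ωb => ?_, fun ωb h => ?_⟩
  · rw [G_split ωb]
    exact le_add_of_nonneg_right
      (Finset.sum_nonneg fun x _ => Finset.sum_nonneg fun y _ => term_nonneg ωb x y)
  · rw [G_split ωb, add_eq_left, Finset.sum_eq_zero_iff_of_nonneg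
      fun x _ => Finset.sum_nonneg fun y _ => term_nonneg ωb x y] at h
    funext x y
    have h_term := (Finset.sum_eq_zero_iff_of_nonneg fun y _ => term_nonneg ωb x y).1
      (h x (Finset.mem_univ x)) y (Finset.mem_univ y)
    exact sub_eq_zero.1 (pow_eq_zero_iff two_ne_zero |>.1
      ((mul_eq_zero.1 h_term).resolve_left (coeff_pos x y).ne'))
end
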